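/- arXiv:1608.04750 — 2 statements merged into one kernel-verified Lean document; each statement's English description precedes it below -/
import Mathlib

section
/- For every bipartite unitary U_{AB→CD}, the tripartite information of its Choi state is nonpositive: I₃(A;C;D) ≤ 0. -/
open Matrix Kronecker Filter
open scoped BigOperators Classical ComplexOrder

noncomputable section

namespace Scrambling

/-- The maximally mixed state on a finite-dimensional system `X`. -/
def mmState (X : Type*) [Fintype X] [DecidableEq X] : Matrix X X ℂ :=
  (Fintype.card X : ℂ)⁻¹ • 1

/-- A (possibly rectangular) matrix is unitary if `U Uᴴ = 1` and `Uᴴ U = 1`. -/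
def IsUnitaryMat {m n : Type*} [Fintype m] [Fintype n] [DecidableEq m] [DecidableEq n]
    (U : Matrix m n ℂ) : Prop :=
  U * Uᴴ = 1 ∧ Uᴴ * U = 1

/-- Reduced density matrix of a pure state `ψ` on `X ⊗ Y`, tracing out `Y`. -/
def redDM {X Y : Type*} [Fintype Y] (ψ : X × Y → ℂ) : Matrix X X ℂ :=
  Matrix.of fun x x' => ∑ y, ψ (x, y) * star (ψ (x', y))

/-- Base-2 von Neumann entropy of a (Hermitian) matrix: `S(ρ) = -tr (ρ log₂ ρ)`,
computed via the eigenvalues. Junk value `0` for non-Hermitian matrices. -/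
def vNE {n : Type*} [Fintype n] [DecidableEq n] (ρ : Matrix n n ℂ) : ℝ :=
  if h : ρ.IsHermitian then (∑ i, Real.negMulLog (h.eigenvalues i)) / Real.log 2 else 0

/-- Trace norm `‖X‖₁ = tr √(XᴴX)`, via the eigenvalues of `XᴴX`. -/
def traceNorm {n : Type*} [Fintype n] [DecidableEq n] (X : Matrix n n ℂ) : ℝ :=
  ∑ i, Real.sqrt ((Matrix.posSemidef_conjTranspose_mul_self X).1.eigenvalues i)

/-- Density matrix: positive semidefinite with unit trace. -/
def IsDensityMatrix {n : Type*} [Fintype n] (ρ : Matrix n n ℂ) : Prop :=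
  ρ.PosSemidef ∧ ρ.trace = 1

/-- The pure density matrix `|ψ⟩⟨ψ|` associated to a state vector. -/
def pureDM {T : Type*} (ψ : T → ℂ) : Matrix T T ℂ :=
  Matrix.of fun x y => ψ x * star (ψ y)

/-- Extension `id_R ⊗ Φ` of a (linear) map `Φ` on matrices to a reference system `R`. -/
def extendCh {R A C : Type*} (Φ : Matrix A A ℂ → Matrix C C ℂ)
    (ρ : Matrix (R × A) (R × A) ℂ) : Matrix (R × C) (R × C) ℂ :=
  Matrix.of fun p q => Φ (Matrix.of fun x y => ρ (p.1, x) (q.1, y)) p.2 q.2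

/-- Diamond-norm distance between two (linear) maps on matrices:
the supremum over all finite-dimensional reference systems `R = Fin n` and all density
matrices `ρ` on `R ⊗ A` of the trace norm of the difference of the extended outputs. -/
def diamondDist {A C : Type*} [Fintype A] [DecidableEq A] [Fintype C] [DecidableEq C]
    (Φ Ψ : Matrix A A ℂ → Matrix C C ℂ) : ℝ :=
  sSup {x | ∃ (n : ℕ) (ρ : Matrix (Fin n × A) (Fin n × A) ℂ),
    IsDensityMatrix ρ ∧ x = traceNorm (extendCh Φ ρ - extendCh Ψ ρ)}

/-- The unitary quantum channel `σ ↦ U σ Uᴴ`. -/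
def uChannel {m n : Type*} [Fintype m] [Fintype n] (U : Matrix m n ℂ) : Matrix n n ℂ → Matrix m m ℂ :=
  fun σ => U * σ * Uᴴ

/-- The completely depolarizing channel `σ ↦ tr(σ) · τ_C`. -/
def depol (A C : Type*) [Fintype A] [Fintype C] [DecidableEq C] :
    Matrix A A ℂ → Matrix C C ℂ :=
  fun σ => σ.trace • mmState C

section FourParty

variable {A B C D : Type*} [Fintype A] [Fintype B] [Fintype C] [Fintype D]
  [DecidableEq A] [DecidableEq B] [DecidableEq C] [DecidableEq D]

/-- State vector of the Choi state of a bipartite unitary `U : AB → CD`: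
`|U⟩ = (1 ⊗ U)(|Φ⁺⟩_{AA'} ⊗ |Φ⁺⟩_{BB'})`. -/
def choiVec (U : Matrix (C × D) (A × B) ℂ) : (A × B) × C × D → ℂ :=
  fun p => (Real.sqrt (Fintype.card A * Fintype.card B) : ℂ)⁻¹ * U p.2 p.1

/-- Density matrix of the Choi state of a bipartite unitary. -/
def choiDM (U : Matrix (C × D) (A × B) ℂ) :
    Matrix ((A × B) × C × D) ((A × B) × C × D) ℂ :=
  pureDM (choiVec U)

variable (ψ : (A × B) × C × D → ℂ)

/-- Reduced density matrices of a four-party pure state on `A ⊗ B ⊗ C ⊗ D`. -/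
def rhoA : Matrix A A ℂ :=
  redDM fun p : A × (B × C × D) => ψ ((p.1, p.2.1), (p.2.2.1, p.2.2.2))

def rhoB : Matrix B B ℂ :=
  redDM fun p : B × (A × C × D) => ψ ((p.2.1, p.1), (p.2.2.1, p.2.2.2))

def rhoC : Matrix C C ℂ :=
  redDM fun p : C × (A × B × D) => ψ ((p.2.1, p.2.2.1), (p.1, p.2.2.2))

def rhoD : Matrix D D ℂ :=
  redDM fun p : D × (A × B × C) => ψ ((p.2.1, p.2.2.1), (p.2.2.2, p.1))

def rhoAB : Matrix (A × B) (A × B) ℂ := redDM ψ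

def rhoAC : Matrix (A × C) (A × C) ℂ :=
  redDM fun p : (A × C) × B × D => ψ ((p.1.1, p.2.1), (p.1.2, p.2.2))

def rhoAD : Matrix (A × D) (A × D) ℂ :=
  redDM fun p : (A × D) × B × C => ψ ((p.1.1, p.2.1), (p.2.2, p.1.2))

def rhoBC : Matrix (B × C) (B × C) ℂ :=
  redDM fun p : (B × C) × A × D => ψ ((p.2.1, p.1.1), (p.1.2, p.2.2))

def rhoBD : Matrix (B × D) (B × D) ℂ :=
  redDM fun p : (B × D) × A × C => ψ ((p.2.1, p.1.1), (p.2.2, p.1.2))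

def rhoCD : Matrix (C × D) (C × D) ℂ :=
  redDM fun p : (C × D) × A × B => ψ (p.2, p.1)

def rhoABC : Matrix ((A × B) × C) ((A × B) × C) ℂ :=
  redDM fun p : ((A × B) × C) × D => ψ (p.1.1, (p.1.2, p.2))

def rhoABD : Matrix ((A × B) × D) ((A × B) × D) ℂ :=
  redDM fun p : ((A × B) × D) × C => ψ (p.1.1, (p.2, p.1.2))

def rhoACD : Matrix (A × C × D) (A × C × D) ℂ :=
  redDM fun p : (A × C × D) × B => ψ ((p.1.1, p.2), p.1.2)

def rhoBCD : Matrix (B × C × D) (B × C × D) ℂ :=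
  redDM fun p : (B × C × D) × A => ψ ((p.2, p.1.1), p.1.2)

/-- Subsystem von Neumann entropies. -/
def SA : ℝ := vNE (rhoA ψ)
def SB : ℝ := vNE (rhoB ψ)
def SC : ℝ := vNE (rhoC ψ)
def SD : ℝ := vNE (rhoD ψ)
def SAB : ℝ := vNE (rhoAB ψ)
def SAC : ℝ := vNE (rhoAC ψ)
def SAD : ℝ := vNE (rhoAD ψ)
def SBC : ℝ := vNE (rhoBC ψ)
def SBD : ℝ := vNE (rhoBD ψ)
def SCD : ℝ := vNE (rhoCD ψ)
def SABC : ℝ := vNE (rhoABC ψ)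
def SABD : ℝ := vNE (rhoABD ψ)
def SACD : ℝ := vNE (rhoACD ψ)
def SBCD : ℝ := vNE (rhoBCD ψ)

/-- Mutual informations `I(X;Y) = S(X) + S(Y) - S(XY)`. -/
def IAB : ℝ := SA ψ + SB ψ - SAB ψ
def IAC : ℝ := SA ψ + SC ψ - SAC ψ
def IAD : ℝ := SA ψ + SD ψ - SAD ψ
def IBC : ℝ := SB ψ + SC ψ - SBC ψ
def IBD : ℝ := SB ψ + SD ψ - SBD ψ
def ICD : ℝ := SC ψ + SD ψ - SCD ψ
def IACD : ℝ := SA ψ + SCD ψ - SACD ψ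

/-- Tripartite information `I₃(A;C;D) = I(A;C) + I(A;D) - I(A;CD)`. -/
def I3ACD : ℝ := IAC ψ + IAD ψ - IACD ψ

/-- Conditional mutual informations. -/
def cmiAB_C : ℝ := SAC ψ + SBC ψ - SC ψ - SABC ψ
def cmiAB_D : ℝ := SAD ψ + SBD ψ - SD ψ - SABD ψ
def cmiCD_A : ℝ := SAC ψ + SAD ψ - SA ψ - SACD ψ
def cmiCD_B : ℝ := SBC ψ + SBD ψ - SB ψ - SBCD ψ

/-- Rényi-2 entropy `S₂(ρ) = -log₂ tr ρ²`. -/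
def S2 {n : Type*} [Fintype n] (ρ : Matrix n n ℂ) : ℝ :=
  -Real.logb 2 ((ρ * ρ).trace.re)

/-- Rényi-2 tripartite information `I₃⁽²⁾ = S₂(A) + S₂(B) - S₂(AC) - S₂(AD)`. -/
def I3r2 : ℝ := S2 (rhoA ψ) + S2 (rhoB ψ) - S2 (rhoAC ψ) - S2 (rhoAD ψ)

end FourParty

/-- The residual channel `N_{A→C}(σ) = tr_D [U (σ ⊗ τ_B) Uᴴ]`. -/
def residual {A B C D : Type*} [Fintype A] [Fintype B] [Fintype C] [Fintype D]
    [DecidableEq A] [DecidableEq B]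
    (U : Matrix (C × D) (A × B) ℂ) (σ : Matrix A A ℂ) : Matrix C C ℂ :=
  Matrix.of fun c c' => ∑ d, (U * (σ ⊗ₖ mmState B) * Uᴴ) (c, d) (c', d)

/-- A unitary on `X ⊗ X` is a perfect tensor iff all two-party marginals of its
Choi state are maximally mixed. -/
def PerfectTensor {X : Type*} [Fintype X] [DecidableEq X]
    (U : Matrix (X × X) (X × X) ℂ) : Prop :=
  rhoAB (choiVec U) = mmState (X × X) ∧ rhoAC (choiVec U) = mmState (X × X) ∧
  rhoAD (choiVec U) = mmState (X × X) ∧ rhoBC (choiVec U) = mmState (X × X) ∧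
  rhoBD (choiVec U) = mmState (X × X) ∧ rhoCD (choiVec U) = mmState (X × X)

/-- The unitary `U_d` which acts as `U_S` on the subspace spanned by the first `d_S`
basis vectors of each tensor factor, and as the identity otherwise. -/
def embedU (dS d : ℕ) (h : dS ≤ d) (US : Matrix (Fin dS × Fin dS) (Fin dS × Fin dS) ℂ) :
    Matrix (Fin d × Fin d) (Fin d × Fin d) ℂ :=
  Matrix.of fun o i =>
    if hi : i.1.val < dS ∧ i.2.val < dS then
      if ho : o.1.val < dS ∧ o.2.val < dS then
        US (⟨o.1.val, ho.1⟩, ⟨o.2.val, ho.2⟩) (⟨i.1.val, hi.1⟩, ⟨i.2.val, hi.2⟩)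
      else 0
    else if o = i then 1 else 0


lemma three_lines_aux {K : Type*} [Fintype K] (c : K → ℂ) (r : K → ℝ) (M : ℝ) (hM : 0 < M)
    (h0 : ∑ k, c k = 1)
    (hre0 : ∀ z : ℂ, z.re = 0 → ‖∑ k, c k * Complex.exp (z * r k)‖ ≤ 1)
    (hre1 : ∀ z : ℂ, z.re = 1 → ‖∑ k, c k * Complex.exp (z * r k)‖ ≤ M) :
    (∑ k, c k * (r k : ℂ)).re ≤ Real.log M := by
  set F : ℂ → ℂ := fun z => ∑ k, c k * Complex.exp (z * r k) with hF
  have hd : Differentiable ℂ F := by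
    rw [hF]; fun_prop
  have hB : BddAbove ((norm ∘ F) '' Complex.HadamardThreeLines.verticalClosedStrip 0 1) := by
    refine ⟨∑ k, ‖c k‖ * Real.exp |r k|, ?_⟩
    rintro _ ⟨z, hz, rfl⟩
    simp only [Complex.HadamardThreeLines.verticalClosedStrip, Set.mem_preimage, Set.mem_Icc] at hz
    refine (norm_sum_le _ _).trans (Finset.sum_le_sum fun k _ => ?_)
    rw [norm_mul, Complex.norm_exp]
    gcongr
    simp only [Complex.mul_re, Complex.ofReal_re, Complex.ofReal_im, mul_zero, sub_zero]
    calc z.re * r k ≤ z.re * |r k| := by gcongr; exact hz.1; exact le_abs_self _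
      _ ≤ 1 * |r k| := by gcongr; exact hz.2
      _ = _ := one_mul _
  have key : ∀ s : ℝ, 0 ≤ s → s ≤ 1 → (F s).re ≤ Real.exp (s * Real.log M) := by
    intro s hs hs1
    have := Complex.HadamardThreeLines.norm_le_interp_of_mem_verticalClosedStrip₀₁' F (z := (s:ℂ))
      (a := 1) (b := M) (by simp [Complex.HadamardThreeLines.verticalClosedStrip, hs, hs1])
      hd.diffContOnCl hB (fun z hz => hre0 z hz) (fun z hz => hre1 z hz)
    simp only [Complex.ofReal_re, Real.one_rpow, one_mul] at this
    rw [Real.rpow_def_of_pos hM, mul_comm] at this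
    exact (Complex.re_le_norm _).trans this
  -- derivative
  have hderF : HasDerivAt F (∑ k, c k * (r k : ℂ)) 0 := by
    have : HasDerivAt F (∑ k, c k * (Complex.exp (0 * r k) * (1 * r k))) 0 := by
      rw [hF]
      apply HasDerivAt.fun_sum
      intro k _
      exact (((hasDerivAt_id (0:ℂ)).mul_const (r k : ℂ)).cexp).const_mul (c k)
    simpa using this
  have hder : HasDerivAt (fun s : ℝ => (F s).re) (∑ k, c k * (r k : ℂ)).re 0 :=
    HasDerivAt.real_of_complex (by simpa using hderF)
  have hder2 : HasDerivAt (fun s : ℝ => Real.exp (s * Real.log M)) (Real.log M) 0 := by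
    have := ((hasDerivAt_id (0:ℝ)).mul_const (Real.log M)).exp
    simpa using this
  have hsub := hder2.sub hder
  have hF0 : F 0 = 1 := by simp [hF, h0]
  have hlim := hsub.hasDerivWithinAt (s := Set.Ioi 0)
  rw [hasDerivWithinAt_iff_tendsto_slope' (by simp)] at hlim
  have : 0 ≤ Real.log M - (∑ k, c k * (r k : ℂ)).re := by
    refine ge_of_tendsto hlim ?_
    have hmem : Set.Ioo (0:ℝ) 1 ∈ nhdsWithin (0:ℝ) (Set.Ioi 0) := Ioo_mem_nhdsGT one_pos
    filter_upwards [hmem] with s hs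
    rw [slope_def_field]
    have h1 := key s hs.1.le hs.2.le
    apply div_nonneg _ (by linarith [hs.1])
    simp only [Pi.sub_apply, Complex.ofReal_zero, hF0]
    simp
    exact h1
  linarith

lemma frob_self {m n : Type*} [Fintype m] [Fintype n] (A : Matrix m n ℂ) :
    (Aᴴ * A).trace = ((∑ j, ∑ i, ‖A i j‖ ^ 2 : ℝ) : ℂ) := by
  simp only [Matrix.trace, Matrix.diag, Matrix.mul_apply, Matrix.conjTranspose_apply]
  push_cast
  refine Finset.sum_congr rfl fun j _ => Finset.sum_congr rfl fun i _ => ?_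
  rw [Complex.star_def, Complex.conj_mul']

lemma sum_cs {m n : Type*} [Fintype m] [Fintype n] (f g : m → n → ℝ) (x y : ℝ)
    (hx : ∑ j, ∑ i, f i j ^ 2 = x) (hy : ∑ j, ∑ i, g i j ^ 2 = y) :
    ∑ j, ∑ i, f i j * g i j ≤ √x * √y := by
  subst hx hy
  rw [← Fintype.sum_prod_type', ← Fintype.sum_prod_type', ← Fintype.sum_prod_type']
  exact Real.sum_mul_le_sqrt_mul_sqrt _ _ _

lemma frob_cs {m n : Type*} [Fintype m] [Fintype n] (A B : Matrix m n ℂ) (x y : ℝ)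
    (hx : (Aᴴ * A).trace = x) (hy : (Bᴴ * B).trace = y) :
    ‖(Aᴴ * B).trace‖ ≤ √x * √y := by
  rw [frob_self] at hx hy
  norm_cast at hx hy
  refine le_trans ?_ (sum_cs _ _ _ _ hx hy)
  simp only [Matrix.trace, Matrix.diag, Matrix.mul_apply, Matrix.conjTranspose_apply]
  refine (norm_sum_le _ _).trans (Finset.sum_le_sum fun j _ => (norm_sum_le _ _).trans ?_)
  refine Finset.sum_le_sum fun i _ => ?_
  simp

lemma core {n I J B : Type*} [Fintype n] [Fintype I] [Fintype J] [Fintype B]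
    [DecidableEq n] [DecidableEq I] [DecidableEq J] [DecidableEq B] [Nonempty B]
    (W1 : Matrix n I ℂ) (W2 : Matrix n J ℂ) (V : Matrix n B ℂ)
    (h1 : W1 * W1ᴴ = 1) (h1' : W1ᴴ * W1 = 1) (h2 : W2 * W2ᴴ = 1) (h2' : W2ᴴ * W2 = 1)
    (hV : Vᴴ * V = 1) (l : I → ℝ) (m : J → ℝ) (hl : ∀ i, 0 ≤ l i) (hm : ∀ j, 0 ≤ m j)
    (hp : ∀ i, l i = 0 → ∀ β, (W1ᴴ * V) i β = 0)
    (hq : ∀ j, m j = 0 → ∀ β, (W2ᴴ * V) j β = 0)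
    (κ : ℝ) (hκ : 0 < κ)
    (hκ' : ((W1 * diagonal (fun i => (l i : ℂ)) * W1ᴴ) *
      (W2 * diagonal (fun j => (m j : ℂ)) * W2ᴴ)).trace = κ) :
    ∑ i, Real.log (l i) * ∑ β, ‖(W1ᴴ * V) i β‖ ^ 2 +
      ∑ j, Real.log (m j) * ∑ β, ‖(W2ᴴ * V) j β‖ ^ 2
      ≤ Fintype.card B * Real.log (κ / Fintype.card B) := by
  set b : ℝ := (Fintype.card B : ℝ) with hb
  have hb0 : 0 < b := by rw [hb]; exact_mod_cast Fintype.card_pos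
  set G := W1ᴴ * W2 with hG
  set p := W1ᴴ * V with hpd
  set q := W2ᴴ * V with hqd
  set K := q * pᴴ with hK
  have hpp : pᴴ * p = 1 := by
    rw [hpd, conjTranspose_mul, conjTranspose_conjTranspose, Matrix.mul_assoc,
      ← Matrix.mul_assoc W1, h1, Matrix.one_mul, hV]
  have hqq : qᴴ * q = 1 := by
    rw [hqd, conjTranspose_mul, conjTranspose_conjTranspose, Matrix.mul_assoc,
      ← Matrix.mul_assoc W2, h2, Matrix.one_mul, hV]
  have hGq : G * q = p := by
    rw [hG, hqd, hpd, Matrix.mul_assoc, ← Matrix.mul_assoc W2, h2, Matrix.one_mul]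
  have hpG : pᴴ * G = qᴴ := by
    rw [hG, hqd, hpd, conjTranspose_mul, conjTranspose_conjTranspose, Matrix.mul_assoc,
      ← Matrix.mul_assoc W1, h1, Matrix.one_mul, conjTranspose_mul, conjTranspose_conjTranspose]
  -- K frobenius
  have hKK : ∑ i, ∑ j, ‖K j i‖ ^ 2 = b := by
    have h := frob_self K
    have : (Kᴴ * K).trace = b := by
      rw [hK, conjTranspose_mul, conjTranspose_conjTranspose, Matrix.mul_assoc,
        ← Matrix.mul_assoc qᴴ, hqq, Matrix.one_mul, Matrix.trace_mul_comm, hpp, trace_one]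
      simp [hb]
    rw [this] at h
    exact_mod_cast h.symm
  -- weighted G
  have hGG : ∑ i, ∑ j, (√(l i) * √(m j) * ‖G i j‖) ^ 2 = κ := by
    have : ((W1 * diagonal (fun i => (l i : ℂ)) * W1ᴴ) *
      (W2 * diagonal (fun j => (m j : ℂ)) * W2ᴴ)).trace =
      ((diagonal (fun i => (l i : ℂ))) * G * diagonal (fun j => (m j : ℂ)) * Gᴴ).trace := by
      rw [Matrix.mul_assoc W1, Matrix.mul_assoc W1, Matrix.trace_mul_comm, hG, conjTranspose_mul,
        conjTranspose_conjTranspose]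
      simp only [Matrix.mul_assoc]
    rw [this] at hκ'
    have h3 : ((∑ i, ∑ j, (√(l i) * √(m j) * ‖G i j‖) ^ 2 : ℝ) : ℂ) = κ := by
      rw [← hκ']
      push_cast
      simp only [Matrix.trace, Matrix.diag]
      refine Finset.sum_congr rfl fun i _ => ?_
      rw [Matrix.mul_apply]
      refine Finset.sum_congr rfl fun j _ => ?_
      rw [Matrix.mul_diagonal, Matrix.diagonal_mul, conjTranspose_apply, mul_pow, mul_pow,
        ← Complex.ofReal_pow, ← Complex.ofReal_pow, Real.sq_sqrt (hl i), Real.sq_sqrt (hm j),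
        ← Complex.mul_conj', Complex.star_def]
      ring
    exact_mod_cast h3
  have main := three_lines_aux (K := I × J) (fun k => (b:ℂ)⁻¹ * (G k.1 k.2 * K k.2 k.1))
    (fun k => (Real.log (l k.1) + Real.log (m k.2)) / 2) (√κ / √b)
    (by positivity) ?_ ?_ ?_
  · rw [← Real.sqrt_div hκ.le, Real.log_sqrt (by positivity)] at main
    have e1 : ∀ i, ∑ j, G i j * K j i = ((∑ β, ‖p i β‖ ^ 2 : ℝ) : ℂ) := by
      intro i
      have : (G * K) i i = (p * pᴴ) i i := by rw [hK, ← Matrix.mul_assoc, hGq]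
      rw [Matrix.mul_apply, Matrix.mul_apply] at this
      rw [this]
      push_cast
      refine Finset.sum_congr rfl fun β _ => ?_
      rw [conjTranspose_apply, Complex.star_def, Complex.mul_conj']
    have e2 : ∀ j, ∑ i, G i j * K j i = ((∑ β, ‖q j β‖ ^ 2 : ℝ) : ℂ) := by
      intro j
      have : (K * G) j j = (q * qᴴ) j j := by rw [hK, Matrix.mul_assoc, hpG]
      rw [Matrix.mul_apply, Matrix.mul_apply] at this
      simp_rw [mul_comm (G _ _)]
      rw [this]
      push_cast
      refine Finset.sum_congr rfl fun β _ => ?_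
      rw [conjTranspose_apply, Complex.star_def, Complex.mul_conj']
    have e3 : ∑ k : I × J, ((b:ℂ)⁻¹ * (G k.1 k.2 * K k.2 k.1)) *
        (((Real.log (l k.1) + Real.log (m k.2)) / 2 : ℝ) : ℂ) =
        (((2 * b)⁻¹ * (∑ i, Real.log (l i) * ∑ β, ‖p i β‖ ^ 2 +
      ∑ j, Real.log (m j) * ∑ β, ‖q j β‖ ^ 2) : ℝ) : ℂ) := by
      have s1 : ∑ i, ∑ j, (Real.log (l i) : ℂ) * (G i j * K j i) =
          ((∑ i, Real.log (l i) * ∑ β, ‖p i β‖ ^ 2 : ℝ) : ℂ) := by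
        rw [Complex.ofReal_sum]
        refine Finset.sum_congr rfl fun i _ => ?_
        rw [← Finset.mul_sum, e1, Complex.ofReal_mul]
      have s2 : ∑ i, ∑ j, (Real.log (m j) : ℂ) * (G i j * K j i) =
          ((∑ j, Real.log (m j) * ∑ β, ‖q j β‖ ^ 2 : ℝ) : ℂ) := by
        rw [Complex.ofReal_sum, Finset.sum_comm]
        refine Finset.sum_congr rfl fun i _ => ?_
        rw [← Finset.mul_sum, e2, Complex.ofReal_mul]
      rw [Complex.ofReal_mul, Complex.ofReal_add, ← s1, ← s2, ← Finset.sum_add_distrib,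
        Finset.mul_sum, Fintype.sum_prod_type]
      refine Finset.sum_congr rfl fun i _ => ?_
      rw [← Finset.sum_add_distrib, Finset.mul_sum]
      refine Finset.sum_congr rfl fun j _ => ?_
      push_cast
      rw [mul_inv]
      ring
    rw [e3, Complex.ofReal_re] at main
    rw [inv_mul_le_iff₀ (by positivity)] at main
    linarith
  · rw [← Finset.mul_sum, Fintype.sum_prod_type]
    have : (G * K).trace = b := by
      rw [hK, ← Matrix.mul_assoc, hGq, Matrix.trace_mul_comm, hpp, trace_one]
      simp [hb]
    simp only [Matrix.trace, Matrix.diag, Matrix.mul_apply] at this ⊢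
    rw [this]
    exact inv_mul_cancel₀ (by exact_mod_cast hb0.ne')
  · intro z hz
    set u : I → ℂ := fun i => Complex.exp (z * (Real.log (l i) / 2 : ℝ)) with hu
    set v : J → ℂ := fun j => Complex.exp (z * (Real.log (m j) / 2 : ℝ)) with hv
    have hu1 : ∀ i, ‖u i‖ = 1 := by intro i; simp [hu, Complex.norm_exp, hz]
    have hv1 : ∀ i, ‖v i‖ = 1 := by intro i; simp [hv, Complex.norm_exp, hz]
    have hdu : diagonal u * (diagonal u)ᴴ = 1 := by
      rw [diagonal_conjTranspose, diagonal_mul_diagonal, ← diagonal_one]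
      congr 1; funext i
      rw [Pi.star_apply, Complex.star_def, Complex.mul_conj', hu1]; simp
    have hdv : (diagonal v)ᴴ * (diagonal v) = 1 := by
      rw [diagonal_conjTranspose, diagonal_mul_diagonal, ← diagonal_one]
      congr 1; funext i
      rw [Pi.star_apply, Complex.star_def, Complex.conj_mul', hv1]; simp
    have hh := frob_cs (W1 * (diagonal u)ᴴ * p) (W2 * diagonal v * q) b b ?_ ?_
    · have e : ∑ k : I × J, ((b:ℂ)⁻¹ * (G k.1 k.2 * K k.2 k.1)) *
        Complex.exp (z * (((Real.log (l k.1) + Real.log (m k.2)) / 2 : ℝ) : ℂ)) =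
        (b:ℂ)⁻¹ * ((W1 * (diagonal u)ᴴ * p)ᴴ * (W2 * diagonal v * q)).trace := by
        have : ((W1 * (diagonal u)ᴴ * p)ᴴ * (W2 * diagonal v * q)).trace =
            (diagonal u * G * diagonal v * K).trace := by
          simp only [conjTranspose_mul, conjTranspose_conjTranspose]
          rw [Matrix.mul_assoc, Matrix.trace_mul_comm, hK, hG]
          simp only [Matrix.mul_assoc]
        rw [this, Fintype.sum_prod_type]
        simp only [Matrix.trace, Matrix.diag]
        rw [Finset.mul_sum]
        refine Finset.sum_congr rfl fun i _ => ?_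
        rw [Matrix.mul_apply, Finset.mul_sum]
        refine Finset.sum_congr rfl fun j _ => ?_
        rw [Matrix.mul_diagonal, Matrix.diagonal_mul, add_div, Complex.ofReal_add, mul_add,
          Complex.exp_add]
        simp only [hu, hv]
        ring
      rw [e, norm_mul, norm_inv, Complex.norm_real, Real.norm_of_nonneg hb0.le]
      rw [Real.mul_self_sqrt hb0.le] at hh
      rw [inv_mul_le_iff₀ hb0, mul_one]
      exact hh
    · have : (W1 * (diagonal u)ᴴ * p)ᴴ * (W1 * (diagonal u)ᴴ * p) = 1 := by
        simp only [conjTranspose_mul, conjTranspose_conjTranspose]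
        calc _ = pᴴ * (diagonal u * (W1ᴴ * W1) * (diagonal u)ᴴ) * p := by
              simp only [Matrix.mul_assoc]
          _ = 1 := by rw [h1', Matrix.mul_one, hdu, Matrix.mul_one, hpp]
      rw [this, trace_one]; simp [hb]
    · have : (W2 * (diagonal v) * q)ᴴ * (W2 * (diagonal v) * q) = 1 := by
        simp only [conjTranspose_mul]
        calc _ = qᴴ * ((diagonal v)ᴴ * (W2ᴴ * W2) * (diagonal v)) * q := by
              simp only [Matrix.mul_assoc]
          _ = 1 := by rw [h2', Matrix.mul_one, hdv, Matrix.mul_one, hqq]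
      rw [this, trace_one]; simp [hb]
  · intro z hz
    have hcs := sum_cs (fun j i => √(l i) * √(m j) * ‖G i j‖) (fun j i => ‖K j i‖) κ b hGG hKK
    have hle : ‖∑ k : I × J, ((b:ℂ)⁻¹ * (G k.1 k.2 * K k.2 k.1)) *
        Complex.exp (z * (((Real.log (l k.1) + Real.log (m k.2)) / 2 : ℝ) : ℂ))‖ ≤
        b⁻¹ * ∑ i, ∑ j, √(l i) * √(m j) * ‖G i j‖ * ‖K j i‖ := by
      refine (norm_sum_le _ _).trans ?_
      rw [Fintype.sum_prod_type, Finset.mul_sum]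
      refine Finset.sum_le_sum fun i _ => ?_
      rw [Finset.mul_sum]
      refine Finset.sum_le_sum fun j _ => ?_
      dsimp only
      by_cases hi : l i = 0
      · have : K j i = 0 := by
          rw [hK, Matrix.mul_apply]
          exact Finset.sum_eq_zero fun β _ => by rw [conjTranspose_apply, hp i hi]; simp
        simp [this]
      by_cases hj : m j = 0
      · have : K j i = 0 := by
          rw [hK, Matrix.mul_apply]
          exact Finset.sum_eq_zero fun β _ => by rw [hq j hj]; simp
        simp [this]
      have hi' : 0 < l i := lt_of_le_of_ne (hl i) (Ne.symm hi)
      have hj' : 0 < m j := lt_of_le_of_ne (hm j) (Ne.symm hj)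
      have : ‖Complex.exp (z * (((Real.log (l i) + Real.log (m j)) / 2 : ℝ) : ℂ))‖ =
          √(l i) * √(m j) := by
        rw [Complex.norm_exp, Complex.re_mul_ofReal, hz, one_mul, add_div, Real.exp_add,
          ← Real.log_sqrt hi'.le, ← Real.log_sqrt hj'.le, Real.exp_log (Real.sqrt_pos.2 hi'),
          Real.exp_log (Real.sqrt_pos.2 hj')]
      rw [norm_mul, this, norm_mul, norm_mul, norm_inv, Complex.norm_real,
        Real.norm_of_nonneg hb0.le]
      apply le_of_eq; ring
    refine hle.trans ?_
    rw [inv_mul_le_iff₀ hb0]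
    refine hcs.trans (le_of_eq ?_)
    have : √b * √b = b := Real.mul_self_sqrt hb0.le
    have h5 : √b ≠ 0 := (Real.sqrt_pos.2 hb0).ne'
    field_simp
    rw [sq, this]

lemma redDM_psd {X Y : Type*} [Fintype X] [Fintype Y] (ψ : X × Y → ℂ) : (redDM ψ).PosSemidef := by
  have : redDM ψ = (Matrix.of fun x y => ψ (x, y)) * (Matrix.of fun x y => ψ (x, y))ᴴ := by
    ext x x'
    simp [redDM, Matrix.mul_apply, Matrix.conjTranspose_apply]
  rw [this]
  exact posSemidef_self_mul_conjTranspose _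

lemma vNE_flat {n : Type*} [Fintype n] [DecidableEq n] (ρ : Matrix n n ℂ) (h : ρ.IsHermitian)
    (k : ℝ) (hk : 0 < k) (hsq : ρ * ρ = (k : ℂ)⁻¹ • ρ) (htr : ρ.trace = 1) :
    vNE ρ = Real.log k / Real.log 2 := by
  rw [vNE, dif_pos h]
  congr 1
  have hev : ∀ i, h.eigenvalues i = 0 ∨ h.eigenvalues i = k⁻¹ := by
    intro i
    have h1 := h.mulVec_eigenvectorBasis i
    have hne : (h.eigenvectorBasis i).ofLp ≠ 0 := by
      intro h0
      have := h.eigenvectorBasis.orthonormal.ne_zero i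
      exact this (by ext j; simpa using congrFun h0 j)
    have h2 : (ρ * ρ) *ᵥ (h.eigenvectorBasis i).ofLp =
        (h.eigenvalues i * h.eigenvalues i : ℝ) • (h.eigenvectorBasis i).ofLp := by
      rw [← Matrix.mulVec_mulVec, h1, Matrix.mulVec_smul, h1, smul_smul]
    rw [hsq, Matrix.smul_mulVec, h1] at h2
    have h3 : (h.eigenvalues i * h.eigenvalues i - k⁻¹ * h.eigenvalues i : ℝ) •
        (h.eigenvectorBasis i).ofLp = 0 := by
      rw [sub_smul, ← h2, mul_smul]
      ext j
      simp
    rcases smul_eq_zero.1 h3 with h4 | h4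
    · have : h.eigenvalues i * (h.eigenvalues i - k⁻¹) = 0 := by linarith
      rcases mul_eq_zero.1 this with h5 | h5
      · exact Or.inl h5
      · exact Or.inr (by linarith)
    · exact absurd h4 hne
  have hsum : ∑ i, h.eigenvalues i = 1 := by
    have := h.trace_eq_sum_eigenvalues
    rw [htr] at this
    have h2 : ((∑ i, h.eigenvalues i : ℝ) : ℂ) = 1 := by
      rw [this]; push_cast; rfl
    exact_mod_cast h2
  have : ∀ i, Real.negMulLog (h.eigenvalues i) = h.eigenvalues i * Real.log k := by
    intro i
    rcases hev i with h0 | h0 <;> rw [h0]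
    · simp
    · simp [Real.negMulLog]
  rw [Finset.sum_congr rfl fun i _ => this i, ← Finset.sum_mul, hsum, one_mul]

lemma vNE_mm {n : Type*} [Fintype n] [DecidableEq n] (k : ℕ) (hk : 0 < k)
    (hc : Fintype.card n = k) :
    vNE ((k : ℂ)⁻¹ • (1 : Matrix n n ℂ)) = Real.log k / Real.log 2 := by
  have hk' : (k : ℂ) ≠ 0 := by exact_mod_cast hk.ne'
  apply vNE_flat
  · rw [Matrix.IsHermitian, conjTranspose_smul, conjTranspose_one]; simp
  · exact_mod_cast hk
  · simp
  · rw [trace_smul, trace_one, hc, smul_eq_mul, inv_mul_cancel₀ hk']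

lemma vNE_zero {n : Type*} [Fintype n] [DecidableEq n] : vNE (0 : Matrix n n ℂ) = 0 := by
  rw [vNE, dif_pos (Matrix.isHermitian_zero)]
  have : (Matrix.isHermitian_zero : (0 : Matrix n n ℂ).IsHermitian).eigenvalues = 0 := by
    rw [Matrix.IsHermitian.eigenvalues_eq_zero_iff]
  simp [this]

lemma lift_eig {n R S B : Type*} [Fintype n] [Fintype R] [Fintype S] [Fintype B]
    [DecidableEq n] [DecidableEq R] [DecidableEq S] (e : n ≃ R × S)
    (V : Matrix n B ℂ) (ρ : Matrix R R ℂ) (hρ : ρ.IsHermitian) (b : ℝ)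
    (hb : ∀ r r', (b : ℂ) * ρ r r' =
      ∑ s, ∑ β, V (e.symm (r, s)) β * star (V (e.symm (r', s)) β)) :
    ∃ W : Matrix n (R × S) ℂ, W * Wᴴ = 1 ∧ Wᴴ * W = 1 ∧
      W * (diagonal (fun i : R × S => (hρ.eigenvalues i.1 : ℂ)) :
        Matrix (R × S) (R × S) ℂ) * Wᴴ =
        (ρ ⊗ₖ (1 : Matrix S S ℂ)).submatrix e e ∧
      ∀ i, ∑ s, ∑ β, ‖(Wᴴ * V) (i, s) β‖ ^ 2 = b * hρ.eigenvalues i := by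
  set E : Matrix R R ℂ := (hρ.eigenvectorUnitary : Matrix R R ℂ) with hE
  have hE1 : E * Eᴴ = 1 := by
    have := (Matrix.mem_unitaryGroup_iff).1 hρ.eigenvectorUnitary.2
    rwa [star_eq_conjTranspose] at this
  have hE2 : Eᴴ * E = 1 := by
    have := (Matrix.mem_unitaryGroup_iff').1 hρ.eigenvectorUnitary.2
    rwa [star_eq_conjTranspose] at this
  have hspec : ρ = E * diagonal (fun i => (hρ.eigenvalues i : ℂ)) * Eᴴ := by
    have := hρ.spectral_theorem
    rw [Unitary.conjStarAlgAut_apply] at this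
    exact this
  have hWh : ((E ⊗ₖ (1 : Matrix S S ℂ)).submatrix e id)ᴴ =
      (Eᴴ ⊗ₖ (1 : Matrix S S ℂ)).submatrix id e := by
    rw [conjTranspose_submatrix, conjTranspose_kronecker, conjTranspose_one]
  refine ⟨(E ⊗ₖ (1 : Matrix S S ℂ)).submatrix e id, ?_, ?_, ?_, ?_⟩
  · rw [hWh, ← submatrix_mul _ _ _ _ _ Function.bijective_id, ← mul_kronecker_mul, hE1,
      Matrix.one_mul, one_kronecker_one, submatrix_one_equiv]
  · rw [hWh, ← submatrix_mul _ _ _ _ _ e.bijective, ← mul_kronecker_mul, hE2,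
      Matrix.one_mul, one_kronecker_one, submatrix_id_id]
  · have hd : diagonal (fun i : R × S => (hρ.eigenvalues i.1 : ℂ)) =
        ((diagonal (fun i => (hρ.eigenvalues i : ℂ))) ⊗ₖ (1 : Matrix S S ℂ)) := by
      rw [← diagonal_one, diagonal_kronecker_diagonal]; simp
    have hd' : diagonal (fun i : R × S => (hρ.eigenvalues i.1 : ℂ)) =
        (((diagonal (fun i => (hρ.eigenvalues i : ℂ))) ⊗ₖ (1 : Matrix S S ℂ))).submatrix id id := by
      rw [hd, submatrix_id_id]
    rw [hWh, hd', ← submatrix_mul _ _ _ _ _ Function.bijective_id,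
      ← submatrix_mul _ _ _ _ _ Function.bijective_id, ← mul_kronecker_mul, ← mul_kronecker_mul,
      ← hspec, Matrix.one_mul, Matrix.one_mul]
  · intro i
    set N : Matrix R (S × B) ℂ := Matrix.of fun r sb => V (e.symm (r, sb.1)) sb.2 with hN
    have hNN : N * Nᴴ = (b : ℂ) • ρ := by
      ext r r'
      rw [Matrix.smul_apply, smul_eq_mul, hb, Matrix.mul_apply, Fintype.sum_prod_type]
      rfl
    have hWV : ∀ s β, (((E ⊗ₖ (1 : Matrix S S ℂ)).submatrix e id)ᴴ * V) (i, s) β =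
        (Eᴴ * N) i (s, β) := by
      intro s β
      rw [hWh, Matrix.mul_apply, Matrix.mul_apply, ← e.symm.sum_comp, Fintype.sum_prod_type]
      refine Finset.sum_congr rfl fun r _ => ?_
      rw [Finset.sum_eq_single s]
      · simp [hN, kroneckerMap_apply]
      · intro s' _ hs'
        simp [kroneckerMap_apply, Matrix.one_apply, hs'.symm]
      · simp
    have h1 : (Eᴴ * N) * (Eᴴ * N)ᴴ = (b : ℂ) • diagonal (fun i => (hρ.eigenvalues i : ℂ)) := by
      rw [conjTranspose_mul, conjTranspose_conjTranspose, Matrix.mul_assoc, ← Matrix.mul_assoc N,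
        hNN, Matrix.smul_mul, Matrix.mul_smul]
      congr 1
      conv_lhs => rw [hspec]
      calc _ = (Eᴴ * E) * diagonal (fun i => (hρ.eigenvalues i : ℂ)) * (Eᴴ * E) := by
            simp only [Matrix.mul_assoc]
        _ = _ := by rw [hE2, Matrix.one_mul, Matrix.mul_one]
    have h2 := congrFun (congrFun h1 i) i
    rw [Matrix.mul_apply, Fintype.sum_prod_type, Matrix.smul_apply, diagonal_apply_eq,
      smul_eq_mul] at h2
    have h3 : ((∑ s, ∑ β, ‖(Eᴴ * N) i (s, β)‖ ^ 2 : ℝ) : ℂ) =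
        ((b * hρ.eigenvalues i : ℝ) : ℂ) := by
      rw [Complex.ofReal_mul, ← h2]
      push_cast
      refine Finset.sum_congr rfl fun s _ => Finset.sum_congr rfl fun β _ => ?_
      rw [conjTranspose_apply, Complex.star_def, Complex.mul_conj']
    simp_rw [hWV]
    exact_mod_cast h3

/-- For every bipartite unitary `U_{AB→CD}`, the tripartite information
`I₃(A;C;D)` of its Choi state is nonpositive. -/
theorem tripartite_information_nonpos (a b c d : ℕ) (hdim : a * b = c * d)
    (U : Matrix (Fin c × Fin d) (Fin a × Fin b) ℂ) (hU : IsUnitaryMat U) :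
    I3ACD (choiVec U) ≤ 0 := by
  rcases Nat.eq_zero_or_pos (a * b) with hz | hpos
  · have hψ : choiVec U = 0 := by
      funext p
      rcases Nat.mul_eq_zero.1 hz with h | h
      · subst h; exact p.1.1.elim0
      · subst h; exact p.1.2.elim0
    have hred : ∀ {X Y : Type} [Fintype Y], redDM (fun _ : X × Y => (0 : ℂ)) = 0 := by
      intro X Y _
      ext x x'
      simp [redDM]
    simp only [I3ACD, IAC, IAD, IACD, SA, SC, SD, SAC, SAD, SCD, SACD, rhoA, rhoC, rhoD, rhoAC,
      rhoAD, rhoCD, rhoACD, hψ, Pi.zero_apply, hred, vNE_zero]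
    norm_num
  have ha : 0 < a := Nat.pos_of_mul_pos_right hpos
  have hb : 0 < b := Nat.pos_of_mul_pos_left hpos
  have hc : 0 < c := Nat.pos_of_mul_pos_right (hdim ▸ hpos)
  have hd : 0 < d := Nat.pos_of_mul_pos_left (hdim ▸ hpos)
  have ha' : (a : ℂ) ≠ 0 := by exact_mod_cast ha.ne'
  have hb' : (b : ℂ) ≠ 0 := by exact_mod_cast hb.ne'
  have hc' : (c : ℂ) ≠ 0 := by exact_mod_cast hc.ne'
  have hd' : (d : ℂ) ≠ 0 := by exact_mod_cast hd.ne'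
  have hdim' : (a : ℂ) * b = c * d := by exact_mod_cast hdim
  have hu1 : ∀ p q, ∑ x, ∑ y, U p (x, y) * star (U q (x, y)) = if p = q then 1 else 0 := by
    intro p q
    have := congrFun (congrFun hU.1 p) q
    rw [Matrix.mul_apply, Fintype.sum_prod_type, Matrix.one_apply] at this
    exact this
  have hu2 : ∀ x y, ∑ p, ∑ q, U (p, q) x * star (U (p, q) y) = if x = y then 1 else 0 := by
    intro x y
    have := congrFun (congrFun hU.2 y) x
    rw [Matrix.mul_apply, Fintype.sum_prod_type, Matrix.one_apply] at this
    simp only [conjTranspose_apply, eq_comm (a := y)] at this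
    rw [← this]
    exact Finset.sum_congr rfl fun p _ => Finset.sum_congr rfl fun q _ => mul_comm _ _
  have hψ : ∀ p q, choiVec U p * star (choiVec U q) =
      ((a : ℂ) * b)⁻¹ * (U p.2 p.1 * star (U q.2 q.1)) := by
    intro p q
    have h1 : ((√((a : ℝ) * b) : ℝ) : ℂ) * ((√((a : ℝ) * b) : ℝ) : ℂ) = a * b := by
      rw [← Complex.ofReal_mul, Real.mul_self_sqrt (by positivity)]; push_cast; rfl
    simp only [choiVec, Fintype.card_fin]
    rw [star_mul', star_inv₀, Complex.star_def, Complex.conj_ofReal, ← h1, mul_inv]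
    ring
  have rA : rhoA (choiVec U) = (a : ℂ)⁻¹ • 1 := by
    ext x x'
    simp only [rhoA, redDM, Matrix.of_apply, hψ, Fintype.sum_prod_type, ← Finset.mul_sum, hu2,
      Prod.mk.injEq, and_true, Finset.sum_const, Finset.card_univ, Fintype.card_fin,
      Matrix.smul_apply, Matrix.one_apply]
    split_ifs <;> simp
    field_simp
  have rC : rhoC (choiVec U) = (c : ℂ)⁻¹ • 1 := by
    ext x x'
    have : ∀ f : Fin a → Fin b → Fin d → ℂ, ∑ i, ∑ j, ∑ k, f i j k = ∑ k, ∑ i, ∑ j, f i j k := by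
      intro f
      rw [Finset.sum_comm]
      simp_rw [Finset.sum_comm (γ := Fin d)]
      rw [Finset.sum_comm]
    simp only [rhoC, redDM, Matrix.of_apply, hψ, Fintype.sum_prod_type, ← Finset.mul_sum, this, hu1,
      Prod.mk.injEq, and_true, Finset.sum_const, Finset.card_univ, Fintype.card_fin,
      Matrix.smul_apply, Matrix.one_apply, hdim']
    split_ifs <;> simp
    field_simp
  have rD : rhoD (choiVec U) = (d : ℂ)⁻¹ • 1 := by
    ext x x'
    have : ∀ f : Fin a → Fin b → Fin c → ℂ, ∑ i, ∑ j, ∑ k, f i j k = ∑ k, ∑ i, ∑ j, f i j k := by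
      intro f
      rw [Finset.sum_comm]
      simp_rw [Finset.sum_comm (γ := Fin c)]
      rw [Finset.sum_comm]
    simp only [rhoD, redDM, Matrix.of_apply, hψ, Fintype.sum_prod_type, ← Finset.mul_sum, this, hu1,
      Prod.mk.injEq, true_and, Finset.sum_const, Finset.card_univ, Fintype.card_fin,
      Matrix.smul_apply, Matrix.one_apply, hdim']
    split_ifs <;> simp
    field_simp
  have rCD : rhoCD (choiVec U) = ((c * d : ℕ) : ℂ)⁻¹ • 1 := by
    ext x x'
    simp only [rhoCD, redDM, Matrix.of_apply, hψ, Fintype.sum_prod_type, ← Finset.mul_sum, hu1,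
      Matrix.smul_apply, Matrix.one_apply, hdim', smul_eq_mul, Nat.cast_mul]
  set V : Matrix (Fin a × Fin c × Fin d) (Fin b) ℂ :=
    Matrix.of fun x β => ((√(a : ℝ) : ℝ) : ℂ)⁻¹ * U x.2 (x.1, β) with hVdef
  have hVV : ∀ x β y γ, V x β * star (V y γ) = (a : ℂ)⁻¹ *
      (U x.2 (x.1, β) * star (U y.2 (y.1, γ))) := by
    intro x β y γ
    have h1 : ((√(a : ℝ) : ℝ) : ℂ) * ((√(a : ℝ) : ℝ) : ℂ) = a := by
      rw [← Complex.ofReal_mul, Real.mul_self_sqrt (by positivity)]; push_cast; rfl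
    have h2 : (a : ℂ)⁻¹ = ((√(a : ℝ) : ℝ) : ℂ)⁻¹ * ((√(a : ℝ) : ℝ) : ℂ)⁻¹ := by
      rw [← mul_inv, h1]
    simp only [hVdef, Matrix.of_apply]
    rw [star_mul', star_inv₀, Complex.star_def, Complex.conj_ofReal, h2]
    ring
  have hV1 : Vᴴ * V = 1 := by
    ext β γ
    rw [Matrix.mul_apply]
    simp only [conjTranspose_apply, mul_comm (star _), hVV, Fintype.sum_prod_type,
      ← Finset.mul_sum, hu2, Prod.mk.injEq, true_and, Finset.sum_const, Finset.card_univ,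
      Fintype.card_fin, Matrix.one_apply, eq_comm (a := γ)]
    split_ifs <;> simp
    field_simp
  have rACD : rhoACD (choiVec U) = (b : ℂ)⁻¹ • (V * Vᴴ) := by
    ext x y
    rw [Matrix.smul_apply, Matrix.mul_apply]
    simp only [conjTranspose_apply, hVV, rhoACD, redDM, Matrix.of_apply, hψ, smul_eq_mul,
      ← Finset.mul_sum, mul_inv]
    ring
  have sA : SA (choiVec U) = Real.log a / Real.log 2 := by
    rw [SA, rA]; exact vNE_mm a ha (by simp)
  have sC : SC (choiVec U) = Real.log c / Real.log 2 := by
    rw [SC, rC]; exact vNE_mm c hc (by simp)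
  have sD : SD (choiVec U) = Real.log d / Real.log 2 := by
    rw [SD, rD]; exact vNE_mm d hd (by simp)
  have sCD : SCD (choiVec U) = Real.log (c * d : ℕ) / Real.log 2 := by
    rw [SCD, rCD]; exact vNE_mm (c * d) (by positivity) (by simp)
  have sACD : SACD (choiVec U) = Real.log b / Real.log 2 := by
    rw [SACD]
    apply vNE_flat (rhoACD (choiVec U)) (redDM_psd _).1 _ (by exact_mod_cast hb)
    · rw [rACD, Matrix.smul_mul, Matrix.mul_smul, Matrix.mul_assoc V, ← Matrix.mul_assoc Vᴴ, hV1,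
        Matrix.one_mul]
      simp
    · rw [rACD, trace_smul, Matrix.trace_mul_comm, hV1, trace_one, Fintype.card_fin, smul_eq_mul,
        inv_mul_cancel₀ hb']
  -- the two nontrivial marginals
  have hAC := redDM_psd (fun p : (Fin a × Fin c) × Fin b × Fin d =>
    choiVec U ((p.1.1, p.2.1), (p.1.2, p.2.2)))
  have hAD := redDM_psd (fun p : (Fin a × Fin d) × Fin b × Fin c =>
    choiVec U ((p.1.1, p.2.1), (p.2.2, p.1.2)))
  change (rhoAC (choiVec U)).PosSemidef at hAC
  change (rhoAD (choiVec U)).PosSemidef at hAD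
  let e1 : Fin a × Fin c × Fin d ≃ (Fin a × Fin c) × Fin d := (Equiv.prodAssoc _ _ _).symm
  let e2 : Fin a × Fin c × Fin d ≃ (Fin a × Fin d) × Fin c :=
    { toFun := fun x => ((x.1, x.2.2), x.2.1)
      invFun := fun y => (y.1.1, y.2, y.1.2)
      left_inv := fun _ => rfl
      right_inv := fun _ => rfl }
  obtain ⟨W1, h1, h1', hX, hs1⟩ := lift_eig e1 V (rhoAC (choiVec U)) hAC.1 b (by
    intro r r'
    simp only [rhoAC, redDM, Matrix.of_apply, hψ, Fintype.sum_prod_type, ← Finset.mul_sum, hVV,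
      e1, Equiv.symm_symm, Equiv.prodAssoc_apply]
    rw [Finset.sum_comm]
    push_cast
    rw [mul_inv]
    field_simp)
  obtain ⟨W2, h2, h2', hY, hs2⟩ := lift_eig e2 V (rhoAD (choiVec U)) hAD.1 b (by
    intro r r'
    simp only [rhoAD, redDM, Matrix.of_apply, hψ, Fintype.sum_prod_type, ← Finset.mul_sum, hVV,
      e2, Equiv.coe_fn_symm_mk]
    rw [Finset.sum_comm]
    push_cast
    rw [mul_inv]
    field_simp)
  haveI : Nonempty (Fin b) := ⟨⟨0, hb⟩⟩
  have pAC : ∀ x y, ∑ k, rhoAC (choiVec U) (x, k) (y, k) = if x = y then (a : ℂ)⁻¹ else 0 := by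
    intro x y
    have h := congrFun (congrFun rA x) y
    rw [Matrix.smul_apply, Matrix.one_apply, smul_eq_mul, mul_ite, mul_one, mul_zero] at h
    rw [← h]
    simp only [rhoAC, rhoA, redDM, Matrix.of_apply, Fintype.sum_prod_type]
    rw [Finset.sum_comm]
  have pAD : ∀ x y, ∑ k, rhoAD (choiVec U) (x, k) (y, k) = if x = y then (a : ℂ)⁻¹ else 0 := by
    intro x y
    have h := congrFun (congrFun rA x) y
    rw [Matrix.smul_apply, Matrix.one_apply, smul_eq_mul, mul_ite, mul_one, mul_zero] at h
    rw [← h]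
    simp only [rhoAD, rhoA, redDM, Matrix.of_apply, Fintype.sum_prod_type]
    rw [Finset.sum_comm]
    exact Finset.sum_congr rfl fun _ _ => Finset.sum_comm
  have zero_of : ∀ {S : Type} [Fintype S] (f : S → Fin b → ℂ),
      ∑ s, ∑ β, ‖f s β‖ ^ 2 = 0 → ∀ s β, f s β = 0 := by
    intro S _ f hf s β
    rw [Finset.sum_eq_zero_iff_of_nonneg (fun _ _ => by positivity)] at hf
    have := hf s (Finset.mem_univ _)
    rw [Finset.sum_eq_zero_iff_of_nonneg (fun _ _ => by positivity)] at this
    simpa using this β (Finset.mem_univ _)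
  have hcore := core W1 W2 V h1 h1' h2 h2' hV1 (fun i => hAC.1.eigenvalues i.1)
    (fun j => hAD.1.eigenvalues j.1) (fun i => hAC.eigenvalues_nonneg _)
    (fun j => hAD.eigenvalues_nonneg _)
    (by
      rintro ⟨i, s⟩ hi β
      have h := hs1 i
      rw [show hAC.1.eigenvalues i = 0 from hi, mul_zero] at h
      exact zero_of (fun s β => (W1ᴴ * V) (i, s) β) h s β)
    (by
      rintro ⟨i, s⟩ hi β
      have h := hs2 i
      rw [show hAD.1.eigenvalues i = 0 from hi, mul_zero] at h
      exact zero_of (fun s β => (W2ᴴ * V) (i, s) β) h s β)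
    (a : ℝ)⁻¹ (by positivity)
    (by
      rw [hX, hY]
      have e : ((rhoAC (choiVec U) ⊗ₖ (1 : Matrix (Fin d) (Fin d) ℂ)).submatrix e1 e1 *
          (rhoAD (choiVec U) ⊗ₖ (1 : Matrix (Fin c) (Fin c) ℂ)).submatrix e2 e2).trace =
          ∑ x, ∑ y, (∑ k, rhoAC (choiVec U) (x, k) (y, k)) *
            (∑ k, rhoAD (choiVec U) (y, k) (x, k)) := by
        simp only [Matrix.trace, Matrix.diag, Matrix.mul_apply, Matrix.submatrix_apply,
          kroneckerMap_apply, Fintype.sum_prod_type, Matrix.one_apply, e1, e2,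
          Equiv.prodAssoc_symm_apply, Equiv.coe_fn_mk, mul_ite, mul_one, mul_zero, ite_mul,
          zero_mul, Finset.sum_ite_eq, Finset.sum_ite_eq', Finset.mem_univ, if_true]
        refine Finset.sum_congr rfl fun x _ => ?_
        simp_rw [Finset.sum_mul_sum]
        simp_rw [Finset.sum_comm (γ := Fin a)]
        refine Finset.sum_congr rfl fun x1 _ => Finset.sum_congr rfl fun x2 _ => ?_
        rw [Finset.sum_eq_single x1, Finset.sum_eq_single x2]
        · simp
        · intro y _ hy
          simp [hy.symm]
        · simp
        · intro y _ hy
          simp [hy]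
        · simp
      rw [e]
      simp only [pAC, pAD]
      simp
      field_simp)
  rw [Fintype.card_fin] at hcore
  simp only [Fintype.sum_prod_type, ← Finset.mul_sum, hs1, hs2] at hcore
  have sAC : SAC (choiVec U) = (∑ i, Real.negMulLog (hAC.1.eigenvalues i)) / Real.log 2 := by
    rw [SAC, vNE, dif_pos hAC.1]
  have sAD : SAD (choiVec U) = (∑ i, Real.negMulLog (hAD.1.eigenvalues i)) / Real.log 2 := by
    rw [SAD, vNE, dif_pos hAD.1]
  have ar : (a : ℝ) ≠ 0 := by positivity
  have br : (b : ℝ) ≠ 0 := by positivity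
  have cr : (c : ℝ) ≠ 0 := by positivity
  have dr : (d : ℝ) ≠ 0 := by positivity
  have t1 : ∀ {n m : Type} [Fintype n] [Fintype m] (f : n × m → ℝ),
      ∑ x, ∑ y, Real.log (f (x, y)) * (b * f (x, y)) =
      b * (- ∑ i, Real.negMulLog (f i)) := by
    intro n m _ _ f
    rw [← Fintype.sum_prod_type' (f := fun x y => Real.log (f (x, y)) * (b * f (x, y))), ← Finset.sum_neg_distrib, Finset.mul_sum]
    refine Finset.sum_congr rfl fun i _ => ?_
    rw [Real.negMulLog]; ring
  rw [t1, t1, ← mul_add, Real.log_div (by positivity) br, Real.log_inv] at hcore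
  have hcore2 := le_of_mul_le_mul_left hcore (by positivity)
  have hl2 : 0 < Real.log 2 := Real.log_pos (by norm_num)
  simp only [I3ACD, IAC, IAD, IACD, sA, sC, sD, sCD, sACD, sAC, sAD]
  rw [Nat.cast_mul, Real.log_mul cr dr]
  simp only [← add_div, ← sub_div]
  apply div_nonpos_of_nonpos_of_nonneg _ hl2.le
  linarith

end Scrambling

end
end

section
/- Let d_S ≤ d with d_S odd, and let U_d be the bipartite unitary on ℂ^d⊗ℂ^d defined by U_d|a⟩|b⟩ = U_S|a⟩|b⟩ if a,b < d_S and U_d|a⟩|b⟩ = |a⟩|b⟩ otherwise, with Choi state ρ_{ABCD,d}. Then ‖ρ_{ABCD,d} − Φ⁺_{AC} ⊗ Φ⁺_{BD}‖₁ ≤ 4 d_S/d, where Φ⁺_{AC} ⊗ Φ⁺_{BD} is the Choi state of the identity channel. -/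
open Matrix Kronecker Filter
open scoped BigOperators Classical ComplexOrder

noncomputable section

namespace Scrambling

/-- The Choi state of the identity channel, `Φ⁺_{AC} ⊗ Φ⁺_{BD}`. -/
def idChoiDM (d : ℕ) :
    Matrix ((Fin d × Fin d) × Fin d × Fin d) ((Fin d × Fin d) × Fin d × Fin d) ℂ :=
  Matrix.of fun P Q =>
    (if P.1.1 = P.2.1 ∧ Q.1.1 = Q.2.1 then ((d : ℂ))⁻¹ else 0) *
    (if P.1.2 = P.2.2 ∧ Q.1.2 = Q.2.2 then ((d : ℂ))⁻¹ else 0)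

theorem traceNorm_pure_sub {T : Type*} [Fintype T] [DecidableEq T] (ψ φ : T → ℂ)
    (hψ : star ψ ⬝ᵥ ψ = 1) (hφ : star φ ⬝ᵥ φ = 1) (r : ℝ) (hr : 0 ≤ r)
    (hov : 1 - (star φ ⬝ᵥ ψ).re ≤ 2 * r ^ 2) :
    traceNorm (pureDM ψ - pureDM φ) ≤ 4 * r := by
  have hP : ∀ χ : T → ℂ, pureDM χ = vecMulVec χ (star χ) := fun χ => rfl
  have hH : ∀ χ : T → ℂ, (vecMulVec χ (star χ))ᴴ = vecMulVec χ (star χ) := by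
    intro χ; ext i j; simp [vecMulVec_apply, mul_comm]
  set X := pureDM ψ - pureDM φ with hX
  have hrk : (Xᴴ * X).rank ≤ 2 := by
    rw [Matrix.rank_conjTranspose_mul_self]
    have : X = (Matrix.of fun i (k : Fin 2) => ![ψ i, -φ i] k)
        * (Matrix.of fun (k : Fin 2) j => ![star (ψ j), star (φ j)] k) := by
      rw [hX, hP, hP]; ext i j
      simp [vecMulVec_apply, sub_eq_add_neg, Matrix.mul_apply, Fin.sum_univ_two]
    rw [this]
    refine (Matrix.rank_mul_le_left _ _).trans ?_
    refine (Matrix.rank_le_card_width _).trans ?_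
    simp
  have hconj : star ψ ⬝ᵥ φ = star (star φ ⬝ᵥ ψ) := by
    simp [dotProduct, mul_comm]
  have htr : (Xᴴ * X).trace = ((2 - 2 * ‖star φ ⬝ᵥ ψ‖ ^ 2 : ℝ) : ℂ) := by
    have e1 : ψ ⬝ᵥ star ψ = 1 := by rw [dotProduct_comm]; exact hψ
    have e2 : φ ⬝ᵥ star φ = 1 := by rw [dotProduct_comm]; exact hφ
    have e3 : ψ ⬝ᵥ star φ = star φ ⬝ᵥ ψ := dotProduct_comm _ _
    have e4 : φ ⬝ᵥ star ψ = star (star φ ⬝ᵥ ψ) := by rw [dotProduct_comm]; exact hconj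
    have e5 : (star φ ⬝ᵥ ψ) * star (star φ ⬝ᵥ ψ) = ((‖star φ ⬝ᵥ ψ‖ ^ 2 : ℝ) : ℂ) := by
      rw [Complex.star_def, Complex.mul_conj']; norm_cast
    rw [hX, hP, hP, conjTranspose_sub, hH, hH, sub_mul, mul_sub, mul_sub]
    simp only [vecMulVec_mul_vecMulVec, trace_sub, trace_vecMulVec, dotProduct_smul, smul_dotProduct,
      op_smul_eq_smul, e1, e2, e3, e4, hψ, hφ, hconj, smul_eq_mul]
    push_cast at e5 ⊢
    linear_combination (-2) * e5
  have hh := (Matrix.posSemidef_conjTranspose_mul_self X)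
  have hsum : ∑ i, hh.1.eigenvalues i = 2 - 2 * ‖star φ ⬝ᵥ ψ‖ ^ 2 := by
    have := hh.1.trace_eq_sum_eigenvalues
    rw [htr] at this
    apply Complex.ofReal_injective
    rw [Complex.ofReal_sum]
    exact this.symm
  have hcard := hh.1.rank_eq_card_non_zero_eigs
  rw [Fintype.card_subtype] at hcard
  set S := Finset.univ.filter (fun i => hh.1.eigenvalues i ≠ 0) with hS
  have hn : traceNorm X = ∑ i ∈ S, Real.sqrt (hh.1.eigenvalues i) := by
    unfold traceNorm
    symm
    apply Finset.sum_subset (Finset.subset_univ _)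
    intro i _ hi
    simp [hS] at hi
    simp [hi]
  have hcs := sq_sum_le_card_mul_sum_sq (s := S) (f := fun i => Real.sqrt (hh.1.eigenvalues i))
  have hle : ∑ i ∈ S, Real.sqrt (hh.1.eigenvalues i) ^ 2 ≤ 2 - 2 * ‖star φ ⬝ᵥ ψ‖ ^ 2 := by
    rw [← hsum]
    calc _ ≤ ∑ i, Real.sqrt (hh.1.eigenvalues i) ^ 2 :=
          Finset.sum_le_sum_of_subset_of_nonneg (Finset.subset_univ _) (fun _ _ _ => sq_nonneg _)
      _ = _ := Finset.sum_congr rfl fun i _ => Real.sq_sqrt (hh.eigenvalues_nonneg i)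
  rw [← hn] at hcs
  have hS2 : (S.card : ℝ) ≤ 2 := by
    exact_mod_cast (hcard ▸ hrk : S.card ≤ 2)
  have hnn : 0 ≤ ∑ i ∈ S, Real.sqrt (hh.1.eigenvalues i) ^ 2 :=
    Finset.sum_nonneg fun _ _ => sq_nonneg _
  have hre : (star φ ⬝ᵥ ψ).re ^ 2 ≤ ‖star φ ⬝ᵥ ψ‖ ^ 2 :=
    sq_le_sq' (by linarith [neg_abs_le (star φ ⬝ᵥ ψ).re, Complex.abs_re_le_norm (star φ ⬝ᵥ ψ)])
      (Complex.re_le_norm _)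
  apply abs_le_of_sq_le_sq' _ (by positivity) |>.2
  nlinarith [mul_le_mul_of_nonneg_right hS2 hnn, sq_nonneg (1 - (star φ ⬝ᵥ ψ).re)]

def emb (dS d : ℕ) (h : dS ≤ d) (p : Fin dS × Fin dS) : Fin d × Fin d :=
  (Fin.castLE h p.1, Fin.castLE h p.2)

theorem emb_inj (dS d : ℕ) (h : dS ≤ d) : Function.Injective (emb dS d h) := by
  rintro ⟨a, b⟩ ⟨a', b'⟩ e
  simpa [emb] using e

theorem not_block (dS d : ℕ) (h : dS ≤ d) (o : Fin d × Fin d)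
    (ho : o ∉ Set.range (emb dS d h)) : ¬ (o.1.val < dS ∧ o.2.val < dS) := by
  intro hb
  exact ho ⟨(⟨o.1.val, hb.1⟩, ⟨o.2.val, hb.2⟩), rfl⟩

theorem embedU_col (dS d : ℕ) (h : dS ≤ d)
    (US : Matrix (Fin dS × Fin dS) (Fin dS × Fin dS) ℂ)
    (hu : IsUnitaryMat US) (i : Fin d × Fin d) :
    ∑ o, ‖embedU dS d h US o i‖ ^ 2 = 1 := by
  by_cases hi : i.1.val < dS ∧ i.2.val < dS
  · have h1 : ∑ p, ‖US p (⟨i.1.val, hi.1⟩, ⟨i.2.val, hi.2⟩)‖ ^ 2 = 1 := by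
      have := congrFun (congrFun hu.2 (⟨i.1.val, hi.1⟩, ⟨i.2.val, hi.2⟩))
        (⟨i.1.val, hi.1⟩, ⟨i.2.val, hi.2⟩)
      simp only [Matrix.mul_apply, Matrix.conjTranspose_apply, Matrix.one_apply_eq,
        Complex.star_def, Complex.conj_mul'] at this
      exact_mod_cast this
    rw [← h1]
    symm
    apply Fintype.sum_of_injective (emb dS d h) (emb_inj dS d h)
    · intro o ho
      have := not_block dS d h o ho
      simp only [embedU, Matrix.of_apply]
      rw [dif_pos hi, dif_neg this]; simp
    · intro p
      have : ((emb dS d h p).1.val < dS ∧ (emb dS d h p).2.val < dS) := ⟨p.1.2, p.2.2⟩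
      simp only [embedU, Matrix.of_apply]
      rw [dif_pos hi, dif_pos this]; rfl
  · simp only [embedU, Matrix.of_apply]
    simp_rw [dif_neg hi]
    rw [Finset.sum_eq_single i] <;> simp +contextual

theorem embedU_trace (dS d : ℕ) (h : dS ≤ d)
    (US : Matrix (Fin dS × Fin dS) (Fin dS × Fin dS) ℂ)
    (hu : IsUnitaryMat US) :
    ∑ i, (1 - (embedU dS d h US i i).re) ≤ 2 * (dS : ℝ) ^ 2 := by
  have hs : ∑ i : Fin d × Fin d, (if i.1.val < dS ∧ i.2.val < dS then (2 : ℝ) else 0)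
      = 2 * (dS : ℝ) ^ 2 := by
    trans ∑ _p : Fin dS × Fin dS, (2 : ℝ)
    · symm
      apply Fintype.sum_of_injective (emb dS d h) (emb_inj dS d h)
      · intro o ho
        exact if_neg (not_block dS d h o ho)
      · intro p
        exact (if_pos ⟨p.1.2, p.2.2⟩).symm
    · simp; ring
  rw [← hs]
  apply Finset.sum_le_sum
  intro i _
  split_ifs with hi
  · have h1 : ‖embedU dS d h US i i‖ ^ 2 ≤ 1 := by
      rw [← embedU_col dS d h US hu i]
      exact Finset.single_le_sum (f := fun o => ‖embedU dS d h US o i‖ ^ 2)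
        (fun _ _ => sq_nonneg _) (Finset.mem_univ i)
    have h2 := Complex.abs_re_le_norm (embedU dS d h US i i)
    have h3 : ‖embedU dS d h US i i‖ ≤ 1 := by
      nlinarith [norm_nonneg (embedU dS d h US i i)]
    linarith [neg_abs_le (embedU dS d h US i i).re]
  · simp only [embedU, Matrix.of_apply]
    rw [dif_neg hi]; simp

theorem choiVec_eq (d : ℕ) (U : Matrix (Fin d × Fin d) (Fin d × Fin d) ℂ) (p) :
    choiVec U p = (d : ℂ)⁻¹ * U p.2 p.1 := by
  unfold choiVec
  have : Real.sqrt ((Fintype.card (Fin d) : ℝ) * Fintype.card (Fin d)) = d := by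
    rw [Fintype.card_fin, Real.sqrt_mul_self (Nat.cast_nonneg d)]
  rw [this]; simp

theorem idChoi_eq (d : ℕ) : idChoiDM d
    = pureDM (choiVec (1 : Matrix (Fin d × Fin d) (Fin d × Fin d) ℂ)) := by
  ext ⟨⟨a, b⟩, c, e⟩ ⟨⟨a', b'⟩, c', e'⟩
  simp only [idChoiDM, pureDM, Matrix.of_apply, choiVec_eq, Matrix.one_apply, Prod.mk.injEq]
  by_cases h1 : a = c <;> by_cases h2 : b = e <;> by_cases h3 : a' = c' <;>
    by_cases h4 : b' = e' <;> simp [h1, h2, h3, h4, Ne.symm, eq_comm]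

theorem choi_norm (d : ℕ) (hd : 0 < d) (U : Matrix (Fin d × Fin d) (Fin d × Fin d) ℂ)
    (hU : ∀ i, ∑ o, ‖U o i‖ ^ 2 = 1) : star (choiVec U) ⬝ᵥ choiVec U = 1 := by
  have hd' : (d : ℂ) ≠ 0 := by exact_mod_cast hd.ne'
  have hU' : ∀ i, ∑ o, star (U o i) * U o i = 1 := by
    intro i
    simp only [Complex.star_def, Complex.conj_mul']
    exact_mod_cast hU i
  have : ∀ p, star (choiVec U) p * choiVec U p
      = (d : ℂ)⁻¹ ^ 2 * (star (U p.2 p.1) * U p.2 p.1) := by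
    intro p
    simp only [Pi.star_apply, choiVec_eq, star_mul', star_inv₀, star_natCast]
    ring
  unfold dotProduct
  simp_rw [this]
  rw [← Finset.mul_sum, Fintype.sum_prod_type]
  simp_rw [hU']
  simp
  field_simp

theorem choi_ov (d : ℕ) (U : Matrix (Fin d × Fin d) (Fin d × Fin d) ℂ) :
    star (choiVec (1 : Matrix (Fin d × Fin d) (Fin d × Fin d) ℂ)) ⬝ᵥ choiVec U
      = (((d : ℝ)⁻¹ ^ 2 : ℝ) : ℂ) * ∑ i, U i i := by
  have : ∀ p, star (choiVec (1 : Matrix (Fin d × Fin d) (Fin d × Fin d) ℂ)) p * choiVec U p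
      = (((d : ℝ)⁻¹ ^ 2 : ℝ) : ℂ) * (if p.2 = p.1 then U p.2 p.1 else 0) := by
    intro p
    simp only [Pi.star_apply, choiVec_eq, star_mul', star_inv₀, star_natCast, Matrix.one_apply]
    split_ifs <;> simp
    ring
  unfold dotProduct
  simp_rw [this]
  rw [← Finset.mul_sum, Fintype.sum_prod_type]
  simp

/-- The Choi state of `U_d` is within trace distance `4 d_S / d` of the
Choi state `Φ⁺_{AC} ⊗ Φ⁺_{BD}` of the identity channel. -/
theorem choi_close_to_identity_choi (dS d : ℕ) (h : dS ≤ d) (hodd : Odd dS)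
    (US : Matrix (Fin dS × Fin dS) (Fin dS × Fin dS) ℂ)
    (hUSu : IsUnitaryMat US) (hUSp : PerfectTensor US) :
    traceNorm (choiDM (embedU dS d h US) - idChoiDM d) ≤ 4 * (dS : ℝ) / d := by
  have hd : 0 < d := lt_of_lt_of_le hodd.pos h
  have hdR : (0 : ℝ) < d := by exact_mod_cast hd
  rw [idChoi_eq, choiDM, mul_div_assoc]
  apply traceNorm_pure_sub
  · exact choi_norm d hd _ (embedU_col dS d h US hUSu)
  · apply choi_norm d hd
    intro i
    rw [Finset.sum_eq_single i] <;> simp +contextual [Matrix.one_apply]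
  · positivity
  · rw [choi_ov, Complex.re_ofReal_mul, Complex.re_sum]
    have ht := embedU_trace dS d h US hUSu
    rw [Finset.sum_sub_distrib] at ht
    simp only [Finset.sum_const, Finset.card_univ, Fintype.card_prod, Fintype.card_fin,
      nsmul_eq_mul, mul_one, Nat.cast_mul] at ht
    have : 1 - (d : ℝ)⁻¹ ^ 2 * ∑ i, (embedU dS d h US i i).re
        = (d : ℝ)⁻¹ ^ 2 * ((d : ℝ) * d - ∑ i, (embedU dS d h US i i).re) := by
      field_simp
    rw [this]
    calc _ ≤ (d : ℝ)⁻¹ ^ 2 * (2 * (dS : ℝ) ^ 2) :=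
          mul_le_mul_of_nonneg_left ht (by positivity)
      _ = _ := by field_simp

end Scrambling

end
end
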